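/- arXiv:2604.23089 — 2 statements merged into one kernel-verified Lean document; each statement's English description precedes it below -/
import Mathlib

section
/- Let A_1,…,A_r ∈ M_n(ℂ) be matrices, not all zero, and let η(X) = ∑_{i=1}^r A_i X A_iᴴ be the associated completely positive map. Then the matrix pencil (A_1,…,A_r) is unsplittable if and only if η is indecomposable, i.e., rank(η(B)) > rank(B) for every positive semidefinite B ∈ M_n(ℂ) with 1 ≤ rank(B) ≤ n−1. -/
open Matrix
open scoped ComplexOrder

/-- A matrix pencil `(A 1, …, A r)` of size `n` is *splittable* if there exist subspaces
`R, L ⊆ ℂⁿ` of equal dimension `s` with `1 ≤ s ≤ n - 1` such that `Aᵢ(R) ⊆ L` for all `i`. -/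
def PencilSplittable {n r : ℕ} (A : Fin r → Matrix (Fin n) (Fin n) ℂ) : Prop :=
  ∃ (R L : Submodule ℂ (Fin n → ℂ)),
    1 ≤ Module.finrank ℂ R ∧ Module.finrank ℂ R ≤ n - 1 ∧
    Module.finrank ℂ R = Module.finrank ℂ L ∧
    ∀ i, Submodule.map ((A i).mulVecLin) R ≤ L

/-- A matrix pencil is *unsplittable* if it is nonzero and not splittable. -/
def PencilUnsplittable {n r : ℕ} (A : Fin r → Matrix (Fin n) (Fin n) ℂ) : Prop :=
  (∃ i, A i ≠ 0) ∧ ¬ PencilSplittable A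

/-- A matrix pencil is *LR-semisimple* if, after multiplying by invertible matrices `L` and `R`
on the left and right, it becomes simultaneously block diagonal (for a decomposition
`n = n₁ + ⋯ + n_k`, encoded by the equivalence `e`) with unsplittable diagonal blocks. -/
def PencilLRSemisimple {n r : ℕ} (A : Fin r → Matrix (Fin n) (Fin n) ℂ) : Prop :=
  ∃ (L R : Matrix (Fin n) (Fin n) ℂ), IsUnit L ∧ IsUnit R ∧
    ∃ (k : ℕ) (d : Fin k → ℕ)
      (B : (j : Fin k) → Fin r → Matrix (Fin (d j)) (Fin (d j)) ℂ)
      (e : Fin n ≃ (Σ j : Fin k, Fin (d j))),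
      (∀ i, L * A i * R = (Matrix.blockDiagonal' (fun j => B j i)).submatrix e e) ∧
      ∀ j, PencilUnsplittable (B j)

open scoped MatrixOrder in
/-- A positive semidefinite matrix factors as `C * Cᴴ` with `C` square. -/
theorem Matrix.PosSemidef.exists_eq_mul_conjTranspose {m 𝕜 : Type*} [Fintype m] [RCLike 𝕜]
    {B : Matrix m m 𝕜} (hB : B.PosSemidef) : ∃ C : Matrix m m 𝕜, B = C * Cᴴ := by
  classical
  obtain ⟨D, rfl⟩ := CStarAlgebra.nonneg_iff_eq_star_mul_self.mp hB.nonneg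
  exact ⟨Dᴴ, by rw [conjTranspose_conjTranspose, star_eq_conjTranspose]⟩

/-- The rank of `∑ i, Mᵢ Mᵢᴴ` is the dimension of the sum of the column spaces of the `Mᵢ`. -/
theorem Matrix.rank_sum_mul_conjTranspose {ι m k 𝕜 : Type*} [Fintype ι] [Fintype m] [Fintype k]
    [RCLike 𝕜] (M : ι → Matrix m k 𝕜) :
    (∑ i, M i * (M i)ᴴ).rank =
      Module.finrank 𝕜 (⨆ i, LinearMap.range (M i).mulVecLin : Submodule 𝕜 (m → 𝕜)) := by
  let N : Matrix m (ι × k) 𝕜 := Matrix.of fun a p => M p.1 a p.2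
  have hN : ∑ i, M i * (M i)ᴴ = N * Nᴴ := by
    ext a b
    simp [N, Matrix.sum_apply, Matrix.mul_apply, Fintype.sum_prod_type]
  have hrange : LinearMap.range N.mulVecLin = ⨆ i, LinearMap.range (M i).mulVecLin := by
    simp only [Matrix.range_mulVecLin, ← Submodule.span_iUnion]
    congr 1
    ext v
    simp only [Set.mem_range, Set.mem_iUnion, Prod.exists]
    rfl
  rw [hN, Matrix.rank_self_mul_conjTranspose, Matrix.rank, hrange]

/-- The rank of `∑ i, Aᵢ (C Cᴴ) Aᵢᴴ` is the dimension of the sum of the images under the `Aᵢ`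
of the column space of `C`. -/
theorem Matrix.rank_sum_mul_mul_conjTranspose {ι m k l 𝕜 : Type*} [Fintype ι] [Fintype m]
    [Fintype k] [Fintype l] [RCLike 𝕜] (A : ι → Matrix m k 𝕜) (C : Matrix k l 𝕜) :
    (∑ i, A i * (C * Cᴴ) * (A i)ᴴ).rank =
      Module.finrank 𝕜 (⨆ i, (LinearMap.range C.mulVecLin).map (A i).mulVecLin :
        Submodule 𝕜 (m → 𝕜)) := by
  have hrange (i : ι) : (LinearMap.range C.mulVecLin).map (A i).mulVecLin =
      LinearMap.range (A i * C).mulVecLin := by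
    rw [Matrix.mulVecLin_mul, LinearMap.range_comp]
  rw [iSup_congr hrange, ← Matrix.rank_sum_mul_conjTranspose]
  simp only [Matrix.conjTranspose_mul, Matrix.mul_assoc]

/-- A subspace can be enlarged to any dimension up to that of the ambient space. -/
theorem Submodule.exists_le_finrank_eq {K V : Type*} [Field K] [AddCommGroup V] [Module K V]
    [Module.Finite K V] (W : Submodule K V) {s : ℕ} (hW : Module.finrank K W ≤ s)
    (hs : s ≤ Module.finrank K V) : ∃ L : Submodule K V, W ≤ L ∧ Module.finrank K L = s := by
  induction s, hW using Nat.le_induction with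
  | base => exact ⟨W, le_rfl, rfl⟩
  | succ s _ ih =>
    obtain ⟨L, hWL, hL⟩ := ih (by omega)
    have hne : L < ⊤ := by
      refine lt_top_iff_ne_top.2 fun h => ?_
      rw [h, finrank_top] at hL
      omega
    obtain ⟨v, -, hv⟩ := SetLike.exists_of_lt hne
    exact ⟨L ⊔ K ∙ v, hWL.trans le_sup_left, by rw [finrank_sup_span_singleton hv, hL]⟩

/-- Every subspace is the column space of a square matrix. -/
theorem Matrix.exists_range_mulVecLin_eq {m K : Type*} [Fintype m] [Field K]
    (R : Submodule K (m → K)) : ∃ C : Matrix m m K, LinearMap.range C.mulVecLin = R := by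
  classical
  obtain ⟨Q, hQ⟩ := R.exists_isCompl
  refine ⟨LinearMap.toMatrix' (R.projection Q hQ), ?_⟩
  rw [← Matrix.toLin'_apply', Matrix.toLin'_toMatrix', Submodule.range_projection]

/-- A nonzero pencil `(A₁, …, A_r)` is unsplittable iff the completely
positive map `η(X) = ∑ᵢ Aᵢ X Aᵢᴴ` is indecomposable: `rank(η(B)) > rank(B)` for every
positive semidefinite `B` with `1 ≤ rank B ≤ n - 1`. -/
theorem unsplittable_iff_indecomposable {n r : ℕ}
    (A : Fin r → Matrix (Fin n) (Fin n) ℂ) (hA : ∃ i, A i ≠ 0) :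
    PencilUnsplittable A ↔
      ∀ B : Matrix (Fin n) (Fin n) ℂ, B.PosSemidef →
        1 ≤ B.rank → B.rank ≤ n - 1 → B.rank < (∑ i, A i * B * (A i)ᴴ).rank := by
  refine ⟨fun ⟨_, hns⟩ B hB h1 hn => ?_, fun h => ⟨hA, ?_⟩⟩
  · obtain ⟨C, rfl⟩ := hB.exists_eq_mul_conjTranspose
    rw [Matrix.rank_self_mul_conjTranspose] at h1 hn ⊢
    by_contra! hle
    rw [Matrix.rank_sum_mul_mul_conjTranspose] at hle
    obtain ⟨L, hWL, hL⟩ := Submodule.exists_le_finrank_eq _ hle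
      (by rw [Module.finrank_fin_fun]; omega)
    exact hns ⟨LinearMap.range C.mulVecLin, L, h1, hn, hL.symm,
      fun i => (le_iSup (fun i => (LinearMap.range C.mulVecLin).map (A i).mulVecLin) i).trans hWL⟩
  · rintro ⟨R, L, h1, hn, hRL, hmap⟩
    obtain ⟨C, rfl⟩ := Matrix.exists_range_mulVecLin_eq R
    have hlt := h (C * Cᴴ) (Matrix.posSemidef_self_mul_conjTranspose C)
      (by rwa [Matrix.rank_self_mul_conjTranspose])
      (by rwa [Matrix.rank_self_mul_conjTranspose])
    rw [Matrix.rank_self_mul_conjTranspose, Matrix.rank_sum_mul_mul_conjTranspose] at hlt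
    exact absurd (hlt.trans_le (Submodule.finrank_mono (iSup_le hmap))) hRL.not_lt
end

section
/- Let B_1,…,B_r ∈ M_n(ℂ) satisfy ∑_{i=1}^r B_i B_iᴴ = I and ∑_{i=1}^r B_iᴴ B_i = I (so the completely positive map X ↦ ∑_i B_i X B_iᴴ is doubly stochastic). Then the matrix pencil (B_1,…,B_r) is LR-semisimple. -/
open Matrix
open scoped ComplexOrder

/-- A pencil is *unitarily semisimple* if multiplying by unitary matrices on both sides turns it
into a block diagonal pencil with unsplittable blocks. -/
def PencilUnitarilySemisimple {ι : Type} [Fintype ι] [DecidableEq ι] {r : ℕ}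
    (A : Fin r → Matrix ι ι ℂ) : Prop :=
  ∃ (J : Type) (_ : Fintype J) (_ : DecidableEq J) (d : J → ℕ)
    (B : (j : J) → Fin r → Matrix (Fin (d j)) (Fin (d j)) ℂ)
    (U V : Matrix ι (Σ j, Fin (d j)) ℂ),
    Uᴴ * U = 1 ∧ U * Uᴴ = 1 ∧ Vᴴ * V = 1 ∧ V * Vᴴ = 1 ∧
    (∀ i, Uᴴ * A i * V = Matrix.blockDiagonal' (fun j => B j i)) ∧
    ∀ j, PencilUnsplittable (B j)

theorem PencilUnitarilySemisimple.of_unitary {ι κ : Type} [Fintype ι] [DecidableEq ι]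
    [Fintype κ] [DecidableEq κ] {r : ℕ} {A : Fin r → Matrix ι ι ℂ} {U V : Matrix ι κ ℂ}
    (hU : Uᴴ * U = 1) (hU' : U * Uᴴ = 1) (hV : Vᴴ * V = 1) (hV' : V * Vᴴ = 1)
    (h : PencilUnitarilySemisimple fun i => Uᴴ * A i * V) : PencilUnitarilySemisimple A := by
  obtain ⟨J, _, _, d, B, U₁, V₁, a, b, c, e, f, g⟩ := h
  have inner {X : Matrix ι κ ℂ} {Y : Matrix κ (Σ j, Fin (d j)) ℂ} (hX : Xᴴ * X = 1)
      (hY : Yᴴ * Y = 1) : (X * Y)ᴴ * (X * Y) = 1 := by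
    rw [conjTranspose_mul, Matrix.mul_assoc, ← Matrix.mul_assoc Xᴴ, hX, Matrix.one_mul, hY]
  have outer {X : Matrix ι κ ℂ} {Y : Matrix κ (Σ j, Fin (d j)) ℂ} (hX : X * Xᴴ = 1)
      (hY : Y * Yᴴ = 1) : (X * Y) * (X * Y)ᴴ = 1 := by
    rw [conjTranspose_mul, Matrix.mul_assoc, ← Matrix.mul_assoc Y, hY, Matrix.one_mul, hX]
  refine ⟨J, _, _, d, B, U * U₁, V * V₁, inner hU a, outer hU' b, inner hV c, outer hV' e, ?_, g⟩
  intro i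
  rw [← f i, conjTranspose_mul]
  simp only [Matrix.mul_assoc]

theorem PencilUnitarilySemisimple.fromBlocks {ι κ : Type} [Fintype ι] [DecidableEq ι]
    [Fintype κ] [DecidableEq κ] {r : ℕ} {A : Fin r → Matrix ι ι ℂ} {D : Fin r → Matrix κ κ ℂ}
    (hA : PencilUnitarilySemisimple A) (hD : PencilUnitarilySemisimple D) :
    PencilUnitarilySemisimple fun i => Matrix.fromBlocks (A i) 0 0 (D i) := by
  obtain ⟨J₁, _, _, d₁, B₁, U₁, V₁, a₁, b₁, c₁, e₁, f₁, g₁⟩ := hA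
  obtain ⟨J₂, _, _, d₂, B₂, U₂, V₂, a₂, b₂, c₂, e₂, f₂, g₂⟩ := hD
  let d : J₁ ⊕ J₂ → ℕ := Sum.elim d₁ d₂
  let s : (Σ j, Fin (d j)) ≃ (Σ j, Fin (d₁ j)) ⊕ (Σ j, Fin (d₂ j)) :=
    Equiv.sumSigmaDistrib fun j => Fin (d j)
  let B : (j : J₁ ⊕ J₂) → Fin r → Matrix (Fin (d j)) (Fin (d j)) ℂ :=
    fun j => match j with
      | Sum.inl j => B₁ j
      | Sum.inr j => B₂ j
  refine ⟨J₁ ⊕ J₂, inferInstance, inferInstance, d, B,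
    (Matrix.fromBlocks U₁ 0 0 U₂).submatrix id s, (Matrix.fromBlocks V₁ 0 0 V₂).submatrix id s,
    ?_, ?_, ?_, ?_, ?_, ?_⟩
  · rw [conjTranspose_submatrix, ← submatrix_mul _ _ _ _ _ Function.bijective_id]
    simp [fromBlocks_conjTranspose, fromBlocks_multiply, a₁, a₂]
  · rw [conjTranspose_submatrix, ← submatrix_mul _ _ _ _ _ s.bijective]
    simp [fromBlocks_conjTranspose, fromBlocks_multiply, b₁, b₂]
  · rw [conjTranspose_submatrix, ← submatrix_mul _ _ _ _ _ Function.bijective_id]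
    simp [fromBlocks_conjTranspose, fromBlocks_multiply, c₁, c₂]
  · rw [conjTranspose_submatrix, ← submatrix_mul _ _ _ _ _ s.bijective]
    simp [fromBlocks_conjTranspose, fromBlocks_multiply, e₁, e₂]
  · intro i
    have key : ((Matrix.fromBlocks U₁ 0 0 U₂).submatrix id s)ᴴ * Matrix.fromBlocks (A i) 0 0 (D i) *
        (Matrix.fromBlocks V₁ 0 0 V₂).submatrix id s =
        (Matrix.fromBlocks (U₁ᴴ * A i * V₁) 0 0 (U₂ᴴ * D i * V₂)).submatrix s s := by
      rw [conjTranspose_submatrix, ← submatrix_id_id (Matrix.fromBlocks (A i) 0 0 (D i)),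
        ← submatrix_mul _ _ _ _ _ Function.bijective_id,
        ← submatrix_mul _ _ _ _ _ Function.bijective_id]
      simp [fromBlocks_conjTranspose, fromBlocks_multiply]
    rw [key, f₁, f₂]
    ext ⟨x | x, p⟩ ⟨y | y, q⟩
    · by_cases h : x = y
      · subst h
        exact (blockDiagonal'_apply_eq (fun j => B₁ j i) x p q).trans
          (blockDiagonal'_apply_eq (fun j => B j i) (Sum.inl x) p q).symm
      · exact (blockDiagonal'_apply_ne (fun j => B₁ j i) p q h).trans
          (blockDiagonal'_apply_ne (fun j => B j i) p q (Sum.inl_injective.ne h)).symm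
    · exact (blockDiagonal'_apply_ne (fun j => B j i) p q Sum.inl_ne_inr).symm
    · exact (blockDiagonal'_apply_ne (fun j => B j i) p q Sum.inr_ne_inl).symm
    · by_cases h : x = y
      · subst h
        exact (blockDiagonal'_apply_eq (fun j => B₂ j i) x p q).trans
          (blockDiagonal'_apply_eq (fun j => B j i) (Sum.inr x) p q).symm
      · exact (blockDiagonal'_apply_ne (fun j => B₂ j i) p q h).trans
          (blockDiagonal'_apply_ne (fun j => B j i) p q (Sum.inr_injective.ne h)).symm
  · rintro (j | j)
    · exact g₁ j
    · exact g₂ j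

theorem PencilUnsplittable.pencilUnitarilySemisimple {n r : ℕ}
    {A : Fin r → Matrix (Fin n) (Fin n) ℂ} (hA : PencilUnsplittable A) :
    PencilUnitarilySemisimple A := by
  let e : (Σ _ : Unit, Fin n) ≃ Fin n := Equiv.uniqueSigma fun _ => Fin n
  have inner : ((1 : Matrix (Fin n) (Fin n) ℂ).submatrix id e)ᴴ *
      (1 : Matrix (Fin n) (Fin n) ℂ).submatrix id e = 1 := by
    rw [conjTranspose_submatrix, ← submatrix_mul _ _ _ _ _ Function.bijective_id]
    simp
  have outer : ((1 : Matrix (Fin n) (Fin n) ℂ).submatrix id e) *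
      ((1 : Matrix (Fin n) (Fin n) ℂ).submatrix id e)ᴴ = 1 := by
    rw [conjTranspose_submatrix, ← submatrix_mul _ _ _ _ _ e.bijective]
    simp
  refine ⟨Unit, inferInstance, inferInstance, fun _ => n, fun _ => A, _, _, inner, outer, inner,
    outer, fun i => ?_, fun _ => hA⟩
  rw [conjTranspose_submatrix, ← submatrix_id_id (A i),
    ← submatrix_mul _ _ _ _ _ Function.bijective_id,
    ← submatrix_mul _ _ _ _ _ Function.bijective_id]
  ext ⟨x, p⟩ ⟨y, q⟩
  simp [blockDiagonal'_apply]
  rfl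

theorem PencilUnitarilySemisimple.pencilLRSemisimple {n r : ℕ}
    {A : Fin r → Matrix (Fin n) (Fin n) ℂ} (hA : PencilUnitarilySemisimple A) :
    PencilLRSemisimple A := by
  obtain ⟨J, _, _, d, B, U, V, hU, hU', hV, hV', hB, hB'⟩ := hA
  have hcard : Fintype.card (Fin n) = Fintype.card (Σ j, Fin (d j)) := by
    have h := Matrix.trace_mul_comm Uᴴ U
    rw [hU, hU', trace_one, trace_one] at h
    exact_mod_cast h.symm
  let f : Fin (Fintype.card J) ≃ J := (Fintype.equivFin J).symm
  let g : (Σ j, Fin (d (f j))) ≃ Σ j, Fin (d j) := f.sigmaCongrLeft (β := fun j => Fin (d j))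
  let e : Fin n ≃ Σ j, Fin (d j) := Fintype.equivOfCardEq hcard
  refine ⟨Uᴴ.submatrix e id, V.submatrix id e, ?_, ?_, Fintype.card J, fun j => d (f j),
    fun j => B (f j), e.trans g.symm, fun i => ?_, fun j => hB' _⟩
  · refine IsUnit.of_mul_eq_one (U.submatrix id e) ?_
    rw [← submatrix_mul _ _ _ _ _ Function.bijective_id, hU, submatrix_one_equiv]
  · refine IsUnit.of_mul_eq_one (Vᴴ.submatrix e id) ?_
    rw [← submatrix_mul _ _ _ _ _ e.bijective, hV', submatrix_one _ Function.injective_id]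
  · have hg : (blockDiagonal' fun j => B (f j) i) =
        (blockDiagonal' fun j => B j i).submatrix g g := by
      ext ⟨x, p⟩ ⟨y, q⟩
      by_cases h : x = y
      · subst h
        simp [g, blockDiagonal'_apply]
      · simp [g, blockDiagonal'_apply, h]
    rw [hg, ← hB i, ← submatrix_id_id (A i), ← submatrix_mul _ _ _ _ _ Function.bijective_id,
      ← submatrix_mul _ _ _ _ _ Function.bijective_id, submatrix_submatrix]
    congr 1 <;> ext x : 1 <;> simp

/-- Every subspace of `ℂⁿ` admits an adapted unitary matrix. -/
theorem exists_unitary_adapted {n s t : ℕ} (hst : s + t = n) (R : Submodule ℂ (Fin n → ℂ))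
    (hR : Module.finrank ℂ R = s) :
    ∃ U : Matrix (Fin n) (Fin s ⊕ Fin t) ℂ, Uᴴ * U = 1 ∧ U * Uᴴ = 1 ∧
      (∀ j, U.col (Sum.inl j) ∈ R) ∧
      ∀ j, ∀ x ∈ R, star (U.col (Sum.inr j)) ⬝ᵥ x = 0 := by
  let w := (WithLp.linearEquiv 2 ℂ (Fin n → ℂ)).symm
  let R' : Submodule ℂ (EuclideanSpace ℂ (Fin n)) := R.map w.toLinearMap
  have hR' : Module.finrank ℂ R' = s := by
    rw [← hR]; exact LinearEquiv.finrank_map_eq w R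
  have hRo : Module.finrank ℂ R'ᗮ = t := by
    have h := R'.finrank_add_finrank_orthogonal
    rw [hR', finrank_euclideanSpace, Fintype.card_fin] at h
    omega
  let b := (stdOrthonormalBasis ℂ R').reindex (finCongr hR')
  let c := (stdOrthonormalBasis ℂ R'ᗮ).reindex (finCongr hRo)
  let v : Fin s ⊕ Fin t → EuclideanSpace ℂ (Fin n) :=
    Sum.elim (fun j => (b j : EuclideanSpace ℂ (Fin n))) fun j => c j
  let U : Matrix (Fin n) (Fin s ⊕ Fin t) ℂ := Matrix.of fun x j => v j x
  have hdot (j : Fin s ⊕ Fin t) (x : EuclideanSpace ℂ (Fin n)) :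
      star (U.col j) ⬝ᵥ WithLp.ofLp x = inner ℂ (v j) x := by
    rw [EuclideanSpace.inner_eq_star_dotProduct, dotProduct_comm]
    rfl
  have hUU : Uᴴ * U = 1 := by
    ext j k
    have h : (Uᴴ * U) j k = inner ℂ (v j) (v k) := (hdot j (v k))
    rw [h]
    rcases j with j | j <;> rcases k with k | k
    · simpa [v, Matrix.one_apply] using orthonormal_iff_ite.1 b.orthonormal j k
    · simpa [v, Matrix.one_apply] using
        Submodule.inner_right_of_mem_orthogonal (b j).2 (c k).2
    · simpa [v, Matrix.one_apply] using
        Submodule.inner_left_of_mem_orthogonal (b k).2 (c j).2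
    · simpa [v, Matrix.one_apply] using orthonormal_iff_ite.1 c.orthonormal j k
  refine ⟨U, hUU, (Matrix.mul_eq_one_comm_of_card_eq _ _ _ (by simp [hst])).1 hUU, fun j => ?_,
    fun j x hx => ?_⟩
  · obtain ⟨x, hx, hxb⟩ := (b j).2
    have h : U.col (Sum.inl j) = x := by
      ext k
      exact (congrArg (fun y : EuclideanSpace ℂ (Fin n) => y k) hxb).symm
    exact h ▸ hx
  · have h := hdot (Sum.inr j) (w x)
    refine h.trans ?_
    exact Submodule.inner_left_of_mem_orthogonal (Submodule.mem_map_of_mem hx) (c j).2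

/-- In a doubly stochastic block upper triangular pencil the off-diagonal block vanishes. -/
theorem toBlocks₁₂_eq_zero_of_doubly_stochastic {ι κ : Type} [Fintype ι] [DecidableEq ι]
    [Fintype κ] [DecidableEq κ] {r : ℕ} {C : Fin r → Matrix (ι ⊕ κ) (ι ⊕ κ) ℂ}
    (h1 : ∑ i, C i * (C i)ᴴ = 1) (h2 : ∑ i, (C i)ᴴ * C i = 1)
    (hC : ∀ i, (C i).toBlocks₂₁ = 0) (i : Fin r) : (C i).toBlocks₁₂ = 0 := by
  have e1 : ∑ i, ((C i).toBlocks₁₁ * (C i).toBlocks₁₁ᴴ + (C i).toBlocks₁₂ * (C i).toBlocks₁₂ᴴ)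
      = 1 := by
    ext x y
    have h := congrFun (congrFun h1 (Sum.inl x)) (Sum.inl y)
    simpa [Matrix.sum_apply, Matrix.mul_apply, Matrix.one_apply, toBlocks₁₁, toBlocks₁₂] using h
  have e2 : ∑ i, (C i).toBlocks₁₁ᴴ * (C i).toBlocks₁₁ = 1 := by
    ext x y
    have h0 (i : Fin r) (z : κ) (x : ι) : C i (Sum.inr z) (Sum.inl x) = 0 :=
      congrFun (congrFun (hC i) z) x
    have h := congrFun (congrFun h2 (Sum.inl x)) (Sum.inl y)
    simpa [Matrix.sum_apply, Matrix.mul_apply, Matrix.one_apply, toBlocks₁₁, h0] using h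
  have e3 : ∑ i, ((C i).toBlocks₁₂ * (C i).toBlocks₁₂ᴴ).trace = 0 := by
    have h := congrArg trace (e1.trans e2.symm)
    simp only [trace_sum, trace_add, Finset.sum_add_distrib] at h
    simp only [fun i => trace_mul_comm (C i).toBlocks₁₁ᴴ (C i).toBlocks₁₁] at h
    exact add_eq_left.1 h
  have e4 := (Finset.sum_eq_zero_iff_of_nonneg fun i _ =>
    (posSemidef_self_mul_conjTranspose (C i).toBlocks₁₂).trace_nonneg).1 e3 i (Finset.mem_univ i)
  exact trace_mul_conjTranspose_self_eq_zero_iff.1 e4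

theorem sum_conj_mul_conjTranspose {ι κ : Type} [Fintype ι] [DecidableEq ι]
    [Fintype κ] [DecidableEq κ] {r : ℕ} {A : Fin r → Matrix ι ι ℂ} {U V : Matrix ι κ ℂ}
    (hU : Uᴴ * U = 1) (hV : V * Vᴴ = 1) (h : ∑ i, A i * (A i)ᴴ = 1) :
    ∑ i, (Uᴴ * A i * V) * (Uᴴ * A i * V)ᴴ = 1 := by
  have (i : Fin r) : (Uᴴ * A i * V) * (Uᴴ * A i * V)ᴴ = Uᴴ * (A i * (A i)ᴴ) * U := by
    calc _ = Uᴴ * A i * (V * Vᴴ) * (A i)ᴴ * U := by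
          simp only [conjTranspose_mul, conjTranspose_conjTranspose, Matrix.mul_assoc]
      _ = _ := by simp only [hV, Matrix.mul_one, Matrix.mul_assoc]
  simp only [this]
  rw [← Matrix.sum_mul, ← Matrix.mul_sum, h, Matrix.mul_one, hU]

theorem pencilUnitarilySemisimple_of_doubly_stochastic {r : ℕ} (n : ℕ) :
    ∀ B : Fin r → Matrix (Fin n) (Fin n) ℂ, ∑ i, B i * (B i)ᴴ = 1 → ∑ i, (B i)ᴴ * B i = 1 →
      PencilUnitarilySemisimple B := by
  induction n using Nat.strong_induction_on with
  | _ n ih =>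
  intro B h1 h2
  rcases Nat.eq_zero_or_pos n with rfl | hn
  · exact ⟨Empty, inferInstance, inferInstance, nofun, nofun, 0, 0, Subsingleton.elim _ _,
      Subsingleton.elim _ _, Subsingleton.elim _ _, Subsingleton.elim _ _,
      fun _ => Subsingleton.elim _ _, nofun⟩
  by_cases hs : PencilSplittable B
  swap
  · refine PencilUnsplittable.pencilUnitarilySemisimple ⟨?_, hs⟩
    by_contra! h
    have : NeZero n := ⟨hn.ne'⟩
    simp [h] at h1
  obtain ⟨R, L, hR1, hRn, hRL, hB⟩ := hs
  obtain ⟨s, hs⟩ : ∃ s, Module.finrank ℂ R = s := ⟨_, rfl⟩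
  obtain ⟨t, ht⟩ : ∃ t, s + t = n := ⟨n - s, by omega⟩
  obtain ⟨V, hV, hV', hVR, -⟩ := exists_unitary_adapted ht R hs
  obtain ⟨U, hU, hU', -, hUL⟩ := exists_unitary_adapted ht L (hRL ▸ hs)
  refine PencilUnitarilySemisimple.of_unitary hU hU' hV hV' ?_
  let C i := Uᴴ * B i * V
  have hC1 : ∑ i, C i * (C i)ᴴ = 1 := sum_conj_mul_conjTranspose hU hV' h1
  have hC2 : ∑ i, (C i)ᴴ * C i = 1 := by
    have h := sum_conj_mul_conjTranspose (A := fun i => (B i)ᴴ) hV hU' (by simpa using h2)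
    simpa only [C, conjTranspose_mul, conjTranspose_conjTranspose, Matrix.mul_assoc] using h
  have h21 (i : Fin r) : (C i).toBlocks₂₁ = 0 := by
    ext x y
    have h := hUL x _ (hB i (Submodule.mem_map_of_mem (hVR y)))
    simp only [C, Matrix.mul_assoc]
    exact h
  have h12 := toBlocks₁₂_eq_zero_of_doubly_stochastic hC1 hC2 h21
  have hC (i : Fin r) :
      C i = Matrix.fromBlocks (C i).toBlocks₁₁ 0 0 (C i).toBlocks₂₂ := by
    conv_lhs => rw [← fromBlocks_toBlocks (C i), h12, h21]
  have fromBlocks_sum (X : Fin r → Matrix (Fin s) (Fin s) ℂ) (Y : Fin r → Matrix (Fin t) (Fin t) ℂ)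
      (h : ∑ i, Matrix.fromBlocks (X i) 0 0 (Y i) = 1) : ∑ i, X i = 1 ∧ ∑ i, Y i = 1 := by
    constructor <;> ext x y
    · simpa [Matrix.sum_apply, Matrix.one_apply] using
        congrFun (congrFun h (Sum.inl x)) (Sum.inl y)
    · simpa [Matrix.sum_apply, Matrix.one_apply] using
        congrFun (congrFun h (Sum.inr x)) (Sum.inr y)
  have k1 := fromBlocks_sum (fun i => (C i).toBlocks₁₁ * (C i).toBlocks₁₁ᴴ)
    (fun i => (C i).toBlocks₂₂ * (C i).toBlocks₂₂ᴴ) <| by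
      rw [← hC1]
      refine Finset.sum_congr rfl fun i _ => ?_
      conv_rhs => rw [hC i]
      simp [fromBlocks_conjTranspose, fromBlocks_multiply]
  have k2 := fromBlocks_sum (fun i => (C i).toBlocks₁₁ᴴ * (C i).toBlocks₁₁)
    (fun i => (C i).toBlocks₂₂ᴴ * (C i).toBlocks₂₂) <| by
      rw [← hC2]
      refine Finset.sum_congr rfl fun i _ => ?_
      conv_rhs => rw [hC i]
      simp [fromBlocks_conjTranspose, fromBlocks_multiply]
  have key := (ih s (by omega) _ k1.1 k2.1).fromBlocks (ih t (by omega) _ k1.2 k2.2)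
  rwa [← funext hC] at key

/-- If `∑ᵢ Bᵢ Bᵢᴴ = I` and `∑ᵢ Bᵢᴴ Bᵢ = I` (i.e. the completely positive map
`X ↦ ∑ᵢ Bᵢ X Bᵢᴴ` is doubly stochastic), then the pencil `(B₁, …, B_r)` is LR-semisimple. -/
theorem doubly_stochastic_pencil_lr_semisimple {n r : ℕ}
    (B : Fin r → Matrix (Fin n) (Fin n) ℂ)
    (h1 : ∑ i, B i * (B i)ᴴ = 1) (h2 : ∑ i, (B i)ᴴ * B i = 1) :
    PencilLRSemisimple B :=
  (pencilUnitarilySemisimple_of_doubly_stochastic n B h1 h2).pencilLRSemisimple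
end
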